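/- Let λ > 0, σ ∈ ℝ, and set w^λ(r) = sin(λr) + σ (cos(λr) - e^{-λr}) and ũ_1^λ = D_1 w^λ, where (D_1 w)(r) = w'(r) - w(r)/r. Then: (i) ũ_1^λ satisfies (T_1^2 ũ_1^λ)(r) = λ^4 ũ_1^λ(r) for all r > 0, where (T_1 u)(r) = -u''(r) + 2u(r)/r^2; (ii) the limits ũ_1^λ(r) → 0, (ũ_1^λ)'(r) → -σλ^2, (ũ_1^λ)''(r) → (2(σ-1)/3)λ^3, (ũ_1^λ)'''(r) → 0 hold as r → 0⁺; and (iii) for κ ∈ ℝ with λ ≠ √2 κ, the boundary condition lim_{r→0}(ũ_1^λ)''(r) = -(2√2/3) κ lim_{r→0}(ũ_1^λ)'(r) holds if and only if σ = λ/(λ - √2 κ). -/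

import Mathlib

open Set Filter Topology

/-- The differential operation `(D_1 w)(r) = w'(r) - w(r)/r`, real version. -/
noncomputable def D1R (w : ℝ → ℝ) : ℝ → ℝ :=
  fun r => deriv w r - w r / r

/-- The differential operation `(T_1 u)(r) = -u''(r) + 2u(r)/r²`, real version. -/
noncomputable def T1R (u : ℝ → ℝ) : ℝ → ℝ :=
  fun r => -(deriv (deriv u) r) + 2 * u r / r ^ 2

theorem hasDerivAt_div_pow {f : ℝ → ℝ} {f' r : ℝ} (hf : HasDerivAt f f' r) (hr : r ≠ 0) (n : ℕ) :
    HasDerivAt (fun s => f s / s ^ n) (f' / r ^ n - n * f r / r ^ (n + 1)) r := by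
  refine (hf.fun_div (hasDerivAt_pow n r) (pow_ne_zero n hr)).congr_deriv ?_
  rcases n with _ | n
  · simp
  · simp only [Nat.add_sub_cancel]
    field_simp
    ring

/-- The first derivative of `D1R w` on the half-line. -/
theorem deriv_D1R_eqOn {w w₁ w₂ : ℝ → ℝ} (h₀ : ∀ r, HasDerivAt w (w₁ r) r)
    (h₁ : ∀ r, HasDerivAt w₁ (w₂ r) r) :
    EqOn (deriv (D1R w)) (fun r => w₂ r - w₁ r / r ^ 1 + w r / r ^ 2) (Ioi 0) := by
  have hD : D1R w = fun r => w₁ r - w r / r ^ 1 := by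
    funext r
    simp [D1R, (h₀ r).deriv]
  intro r hr
  have hr0 : r ≠ 0 := (mem_Ioi.mp hr).ne'
  rw [hD, ((h₁ r).fun_sub (hasDerivAt_div_pow (h₀ r) hr0 1)).deriv]
  push_cast
  ring

/-- The second derivative of `D1R w` on the half-line. -/
theorem deriv_deriv_D1R_eqOn {w w₁ w₂ w₃ : ℝ → ℝ} (h₀ : ∀ r, HasDerivAt w (w₁ r) r)
    (h₁ : ∀ r, HasDerivAt w₁ (w₂ r) r) (h₂ : ∀ r, HasDerivAt w₂ (w₃ r) r) :
    EqOn (deriv (deriv (D1R w)))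
      (fun r => w₃ r - w₂ r / r ^ 1 + 2 * (w₁ r / r ^ 2) - 2 * (w r / r ^ 3)) (Ioi 0) := by
  intro r hr
  have hr0 : r ≠ 0 := (mem_Ioi.mp hr).ne'
  rw [(deriv_D1R_eqOn h₀ h₁).deriv isOpen_Ioi hr,
    (((h₂ r).fun_sub (hasDerivAt_div_pow (h₁ r) hr0 1)).fun_add
      (hasDerivAt_div_pow (h₀ r) hr0 2)).deriv]
  push_cast
  ring

/-- The third derivative of `D1R w` on the half-line. -/
theorem deriv_deriv_deriv_D1R_eqOn {w w₁ w₂ w₃ w₄ : ℝ → ℝ} (h₀ : ∀ r, HasDerivAt w (w₁ r) r)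
    (h₁ : ∀ r, HasDerivAt w₁ (w₂ r) r) (h₂ : ∀ r, HasDerivAt w₂ (w₃ r) r)
    (h₃ : ∀ r, HasDerivAt w₃ (w₄ r) r) :
    EqOn (deriv (deriv (deriv (D1R w))))
      (fun r => w₄ r - w₃ r / r ^ 1 + 3 * (w₂ r / r ^ 2) - 6 * (w₁ r / r ^ 3)
        + 6 * (w r / r ^ 4)) (Ioi 0) := by
  intro r hr
  have hr0 : r ≠ 0 := (mem_Ioi.mp hr).ne'
  rw [(deriv_deriv_D1R_eqOn h₀ h₁ h₂).deriv isOpen_Ioi hr,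
    ((((h₃ r).fun_sub (hasDerivAt_div_pow (h₂ r) hr0 1)).fun_add
      ((hasDerivAt_div_pow (h₁ r) hr0 2).const_mul 2)).fun_sub
      ((hasDerivAt_div_pow (h₀ r) hr0 3).const_mul 2)).deriv]
  push_cast
  ring

/-- The intertwining relation `T_1 D_1 w = D_1 (-w'')` on the half-line. -/
theorem T1R_D1R_eqOn {w w₁ w₂ w₃ : ℝ → ℝ} (h₀ : ∀ r, HasDerivAt w (w₁ r) r)
    (h₁ : ∀ r, HasDerivAt w₁ (w₂ r) r) (h₂ : ∀ r, HasDerivAt w₂ (w₃ r) r) :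
    EqOn (T1R (D1R w)) (D1R fun r => -w₂ r) (Ioi 0) := by
  intro r hr
  have hr0 : r ≠ 0 := (mem_Ioi.mp hr).ne'
  rw [T1R, deriv_deriv_D1R_eqOn h₀ h₁ h₂ hr, D1R, D1R, (h₀ r).deriv, (h₂ r).fun_neg.deriv]
  field_simp
  ring

theorem T1R_congr {u v : ℝ → ℝ} (h : EqOn u v (Ioi 0)) : EqOn (T1R u) (T1R v) (Ioi 0) := by
  intro r hr
  rw [T1R, T1R, (h.deriv isOpen_Ioi).deriv isOpen_Ioi hr, h hr]

/-- A form of L'Hôpital's rule raising the order of vanishing at the origin by one. -/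
theorem tendsto_div_pow_succ_of_hasDerivAt {f g : ℝ → ℝ} (hf : ∀ r, HasDerivAt f (g r) r)
    (hf0 : f 0 = 0) (n : ℕ) (hg : Tendsto (fun r => g r / r ^ n) (𝓝[>] 0) (𝓝 0)) :
    Tendsto (fun r => f r / r ^ (n + 1)) (𝓝[>] 0) (𝓝 0) := by
  refine HasDerivAt.lhopital_zero_nhdsGT (f' := g)
    (g' := fun r => ((n + 1 : ℕ) : ℝ) * r ^ n) (Eventually.of_forall hf)
    (Eventually.of_forall fun r => by simpa using hasDerivAt_pow (n + 1) r) ?_ ?_ ?_ ?_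
  · filter_upwards [self_mem_nhdsWithin] with r hr
    have hr0 : 0 < r := hr
    positivity
  · simpa [hf0] using (hf 0).continuousAt.tendsto.mono_left nhdsWithin_le_nhds
  · have h := ((continuous_pow (n + 1)).tendsto (0 : ℝ)).mono_left
      (nhdsWithin_le_nhds (s := Ioi 0))
    simpa using h
  · have h := hg.div_const ((n + 1 : ℕ) : ℝ)
    rw [zero_div] at h
    refine h.congr fun r => ?_
    rw [div_div, mul_comm]

theorem tendsto_div_pow_of_succ {f : ℝ → ℝ} {n : ℕ}
    (h : Tendsto (fun r => f r / r ^ (n + 1)) (𝓝[>] 0) (𝓝 0)) :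
    Tendsto (fun r => f r / r ^ n) (𝓝[>] 0) (𝓝 0) := by
  have hid : Tendsto (fun r : ℝ => r) (𝓝[>] 0) (𝓝 0) := nhdsWithin_le_nhds
  have h' := h.mul hid
  rw [zero_mul] at h'
  refine h'.congr' ?_
  filter_upwards [self_mem_nhdsWithin] with r hr
  have hr0 : r ≠ 0 := (mem_Ioi.mp hr).ne'
  field_simp
  ring

/-- Boundary values at the origin of `D1R w` and its first three derivatives, when `w` has the
Taylor expansion `a r + b r² + c r³ + o(r⁴)`. -/
theorem tendsto_D1R_derivs {w w₁ w₂ w₃ w₄ : ℝ → ℝ} {a b c : ℝ}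
    (h₀ : ∀ r, HasDerivAt w (w₁ r) r) (h₁ : ∀ r, HasDerivAt w₁ (w₂ r) r)
    (h₂ : ∀ r, HasDerivAt w₂ (w₃ r) r) (h₃ : ∀ r, HasDerivAt w₃ (w₄ r) r)
    (z₀ : w 0 = 0) (z₁ : w₁ 0 = a) (z₂ : w₂ 0 = 2 * b) (z₃ : w₃ 0 = 6 * c)
    (z₄ : Tendsto w₄ (𝓝[>] 0) (𝓝 0)) :
    Tendsto (D1R w) (𝓝[>] 0) (𝓝 0) ∧
      Tendsto (deriv (D1R w)) (𝓝[>] 0) (𝓝 b) ∧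
      Tendsto (deriv (deriv (D1R w))) (𝓝[>] 0) (𝓝 (4 * c)) ∧
      Tendsto (deriv (deriv (deriv (D1R w)))) (𝓝[>] 0) (𝓝 0) := by
  have hid : Tendsto (fun r : ℝ => r) (𝓝[>] 0) (𝓝 0) := nhdsWithin_le_nhds
  have t₃ : Tendsto (fun r => (w₃ r - 6 * c) / r ^ 1) (𝓝[>] 0) (𝓝 0) :=
    tendsto_div_pow_succ_of_hasDerivAt (g := w₄)
      (fun r => (h₃ r).sub_const _) (by simp [z₃]) 0 (by simpa using z₄)
  have t₂ : Tendsto (fun r => (w₂ r - (2 * b + 6 * c * r)) / r ^ 2) (𝓝[>] 0) (𝓝 0) :=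
    tendsto_div_pow_succ_of_hasDerivAt (fun r => (h₂ r).fun_sub
      ((((hasDerivAt_id' r).const_mul (6 * c)).const_add (2 * b)).congr_deriv (by ring)))
      (by simp [z₂]) 1 t₃
  have t₁ : Tendsto (fun r => (w₁ r - (a + 2 * b * r + 3 * c * r ^ 2)) / r ^ 3)
      (𝓝[>] 0) (𝓝 0) :=
    tendsto_div_pow_succ_of_hasDerivAt (fun r => (h₁ r).fun_sub
      (((((hasDerivAt_id' r).const_mul (2 * b)).const_add a).fun_add
        ((hasDerivAt_pow 2 r).const_mul (3 * c))).congr_deriv (by push_cast; ring)))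
      (by simp [z₁]) 2 t₂
  have t₀ : Tendsto (fun r => (w r - (a * r + b * r ^ 2 + c * r ^ 3)) / r ^ 4)
      (𝓝[>] 0) (𝓝 0) :=
    tendsto_div_pow_succ_of_hasDerivAt (fun r => (h₀ r).fun_sub
      (((((hasDerivAt_id' r).const_mul a).fun_add ((hasDerivAt_pow 2 r).const_mul b)).fun_add
        ((hasDerivAt_pow 3 r).const_mul c)).congr_deriv (by push_cast; ring)))
      (by simp [z₀]) 3 t₁
  have s₃ := tendsto_div_pow_of_succ (n := 0) t₃
  have s₂ := tendsto_div_pow_of_succ (n := 1) t₂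
  have s₁ := tendsto_div_pow_of_succ (n := 2) t₁
  have s₀ := tendsto_div_pow_of_succ (n := 3) t₀
  have p₂ := tendsto_div_pow_of_succ (n := 0) s₂
  have p₁ := tendsto_div_pow_of_succ (n := 1) s₁
  have p₀ := tendsto_div_pow_of_succ (n := 2) s₀
  have q₁ := tendsto_div_pow_of_succ (n := 0) p₁
  have q₀ := tendsto_div_pow_of_succ (n := 1) p₀
  refine ⟨?_, ?_, ?_, ?_⟩
  · have h := ((q₁.sub q₀).add (hid.const_mul b)).add ((hid.pow 2).const_mul (2 * c))
    refine Tendsto.congr' ?_ (h.trans_eq (by ring_nf))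
    filter_upwards [self_mem_nhdsWithin] with r hr
    have hr0 : r ≠ 0 := (mem_Ioi.mp hr).ne'
    rw [D1R, (h₀ r).deriv]
    field_simp
    ring
  · have h := (((p₂.sub p₁).add p₀).add (hid.const_mul (4 * c))).add_const b
    refine Tendsto.congr' ?_ (h.trans_eq (by ring_nf))
    filter_upwards [self_mem_nhdsWithin] with r hr
    have hr0 : r ≠ 0 := (mem_Ioi.mp hr).ne'
    rw [deriv_D1R_eqOn h₀ h₁ hr]
    field_simp
    ring
  · have h := (((s₃.sub s₂).add (s₁.const_mul 2)).sub (s₀.const_mul 2)).add_const (4 * c)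
    refine Tendsto.congr' ?_ (h.trans_eq (by ring_nf))
    filter_upwards [self_mem_nhdsWithin] with r hr
    have hr0 : r ≠ 0 := (mem_Ioi.mp hr).ne'
    rw [deriv_deriv_D1R_eqOn h₀ h₁ h₂ hr]
    field_simp
    ring
  · have h := (((z₄.sub t₃).add (t₂.const_mul 3)).sub (t₁.const_mul 6)).add (t₀.const_mul 6)
    refine Tendsto.congr' ?_ (h.trans_eq (by ring_nf))
    filter_upwards [self_mem_nhdsWithin] with r hr
    have hr0 : r ≠ 0 := (mem_Ioi.mp hr).ne'
    rw [deriv_deriv_deriv_D1R_eqOn h₀ h₁ h₂ h₃ hr]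
    field_simp
    ring

theorem hasDerivAt_sin_cos_exp (l a b c r : ℝ) :
    HasDerivAt (fun s => a * Real.sin (l * s) + b * Real.cos (l * s) + c * Real.exp (-(l * s)))
      (-(l * b) * Real.sin (l * r) + l * a * Real.cos (l * r) + -(l * c) * Real.exp (-(l * r)))
      r := by
  have hl : HasDerivAt (fun s => l * s) l r := by simpa using (hasDerivAt_id' r).const_mul l
  exact (((hl.sin.const_mul a).fun_add (hl.cos.const_mul b)).fun_add
    (hl.fun_neg.exp.const_mul c)).congr_deriv (by ring)

/-- Continuous-spectrum generalized eigenfunctions of `T_{1κ}²`: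
`ũ_1^λ = D_1(sin(λr) + σ(cos(λr) - e^{-λr}))` satisfies `T_1² ũ_1^λ = λ⁴ ũ_1^λ`,
has boundary limits `ũ_1^λ → 0`, `(ũ_1^λ)' → -σλ²`, `(ũ_1^λ)'' → (2(σ-1)/3)λ³`,
`(ũ_1^λ)''' → 0` as `r → 0⁺`, and fits the boundary condition
`u''(0) = -(2√2/3) κ u'(0)` iff `σ = λ/(λ - √2 κ)`. -/
theorem stmt16 (lam σ : ℝ) (hlam : 0 < lam) :
    (∀ r ∈ Ioi (0 : ℝ),
      T1R (T1R (D1R (fun s => Real.sin (lam * s)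
          + σ * (Real.cos (lam * s) - Real.exp (-(lam * s)))))) r
        = lam ^ 4 * D1R (fun s => Real.sin (lam * s)
          + σ * (Real.cos (lam * s) - Real.exp (-(lam * s)))) r) ∧
    (Tendsto (D1R (fun s => Real.sin (lam * s)
          + σ * (Real.cos (lam * s) - Real.exp (-(lam * s)))))
        (nhdsWithin 0 (Ioi 0)) (nhds 0) ∧
      Tendsto (deriv (D1R (fun s => Real.sin (lam * s)
          + σ * (Real.cos (lam * s) - Real.exp (-(lam * s))))))
        (nhdsWithin 0 (Ioi 0)) (nhds (-σ * lam ^ 2)) ∧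
      Tendsto (deriv (deriv (D1R (fun s => Real.sin (lam * s)
          + σ * (Real.cos (lam * s) - Real.exp (-(lam * s)))))))
        (nhdsWithin 0 (Ioi 0)) (nhds (2 * (σ - 1) / 3 * lam ^ 3)) ∧
      Tendsto (deriv (deriv (deriv (D1R (fun s => Real.sin (lam * s)
          + σ * (Real.cos (lam * s) - Real.exp (-(lam * s))))))))
        (nhdsWithin 0 (Ioi 0)) (nhds 0)) ∧
    (∀ κ : ℝ, lam ≠ Real.sqrt 2 * κ →
      ((∃ L1 L2 : ℝ,
          Tendsto (deriv (D1R (fun s => Real.sin (lam * s)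
              + σ * (Real.cos (lam * s) - Real.exp (-(lam * s))))))
            (nhdsWithin 0 (Ioi 0)) (nhds L1) ∧
          Tendsto (deriv (deriv (D1R (fun s => Real.sin (lam * s)
              + σ * (Real.cos (lam * s) - Real.exp (-(lam * s)))))))
            (nhdsWithin 0 (Ioi 0)) (nhds L2) ∧
          L2 = -(2 * Real.sqrt 2 / 3) * κ * L1)
        ↔ σ = lam / (lam - Real.sqrt 2 * κ))) := by
  have hw : (fun s => Real.sin (lam * s) + σ * (Real.cos (lam * s) - Real.exp (-(lam * s))))
      = fun s => 1 * Real.sin (lam * s) + σ * Real.cos (lam * s)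
        + -σ * Real.exp (-(lam * s)) := by
    funext s
    ring
  rw [hw]
  have h₀ := hasDerivAt_sin_cos_exp lam 1 σ (-σ)
  have h₁ := hasDerivAt_sin_cos_exp lam (-(lam * σ)) (lam * 1) (-(lam * -σ))
  have h₂ := hasDerivAt_sin_cos_exp lam (-(lam * (lam * 1))) (lam * -(lam * σ))
    (-(lam * -(lam * -σ)))
  have h₃ := hasDerivAt_sin_cos_exp lam (-(lam * (lam * -(lam * σ))))
    (lam * -(lam * (lam * 1))) (-(lam * -(lam * -(lam * -σ))))
  have h₄ := hasDerivAt_sin_cos_exp lam (-(lam * (lam * -(lam * (lam * 1)))))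
    (lam * -(lam * (lam * -(lam * σ)))) (-(lam * -(lam * -(lam * -(lam * -σ)))))
  have hlim := tendsto_D1R_derivs (b := -σ * lam ^ 2) (c := (σ - 1) / 6 * lam ^ 3)
    h₀ h₁ h₂ h₃ (by simp) rfl (by simp; ring) (by simp; ring)
    (by
      have h := (h₄ 0).continuousAt.tendsto.mono_left (nhdsWithin_le_nhds (s := Ioi 0))
      refine h.trans_eq ?_
      simp)
  have hc : 4 * ((σ - 1) / 6 * lam ^ 3) = 2 * (σ - 1) / 3 * lam ^ 3 := by ring
  rw [hc] at hlim
  refine ⟨fun r hr => ?_, hlim, fun κ hκ => ?_⟩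
  · rw [T1R_congr (T1R_D1R_eqOn h₀ h₁ h₂) hr,
      T1R_D1R_eqOn (fun r => (h₂ r).fun_neg) (fun r => (h₃ r).fun_neg)
        (fun r => (h₄ r).fun_neg) hr, D1R, D1R, (h₄ r).fun_neg.fun_neg.deriv, (h₀ r).deriv]
    ring
  · have hd : lam - Real.sqrt 2 * κ ≠ 0 := sub_ne_zero.mpr hκ
    rw [eq_div_iff hd]
    constructor
    · rintro ⟨L₁, L₂, hL₁, hL₂, h⟩
      rw [tendsto_nhds_unique hL₁ hlim.2.1, tendsto_nhds_unique hL₂ hlim.2.2.1] at h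
      have hl2 : lam ^ 2 ≠ 0 := by positivity
      refine mul_left_cancel₀ hl2 ?_
      linear_combination 3 / 2 * h
    · intro h
      refine ⟨_, _, hlim.2.1, hlim.2.2.1, ?_⟩
      linear_combination 2 / 3 * lam ^ 2 * h
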